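/- Let n ∈ ℕ, let V be a real vector space, and let T : V ⊗ ℝ[x₁,…,xₙ] → V ⊗ ℝ[x₁,…,xₙ] be an ℝ-linear operator. Then for every α ∈ ℕ₀ⁿ there exists a unique ℝ-linear operator Q_α : V → V ⊗ ℝ[x₁,…,xₙ] such that T(v ⊗ x^β) = Σ_{α⪯β} binom(β,α) · Q_α(v) · x^{β−α} for all β ∈ ℕ₀ⁿ and all v ∈ V; equivalently, T = Σ_{α∈ℕ₀ⁿ} (1/α!) · Q_α × ∂^α, where (Q_α × ∂^α)(v ⊗ x^β) := Q_α(v) · ∂^α x^β. -/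

import Mathlib

noncomputable section

/-- `V`-valued polynomials in `n` variables: finitely supported families of
coefficients indexed by multi-indices; this models `V ⊗ ℝ[x₁,…,xₙ]`. -/
abbrev VPoly (n : ℕ) (V : Type*) [Zero V] : Type _ := (Fin n → ℕ) →₀ V

/-- Multiplication of a `V`-valued polynomial by the monomial `x^γ`. -/
def VPoly.shift {n : ℕ} {V : Type*} [AddCommGroup V] (γ : Fin n → ℕ) (p : VPoly n V) :
    VPoly n V :=
  Finsupp.mapDomain (· + γ) p

/-- The recursive construction of the coefficients. -/
def canonQ {n : ℕ} {V : Type*} [AddCommGroup V] [Module ℝ V]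
    (T : VPoly n V →ₗ[ℝ] VPoly n V) : (Fin n → ℕ) → (V →ₗ[ℝ] VPoly n V) :=
  (wellFounded_lt (α := Fin n → ℕ)).fix fun β ih =>
    T ∘ₗ Finsupp.lsingle β - ∑ α ∈ (Finset.Iio β).attach,
      ((∏ i, (β i).choose (α.1 i) : ℕ) : ℝ) •
        (Finsupp.lmapDomain V ℝ (· + (β - α.1)) ∘ₗ ih α.1 (Finset.mem_Iio.1 α.2))

theorem canonQ_apply {n : ℕ} {V : Type*} [AddCommGroup V] [Module ℝ V]
    (T : VPoly n V →ₗ[ℝ] VPoly n V) (β : Fin n → ℕ) (v : V) :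
    canonQ T β v = T (Finsupp.single β v) - ∑ α ∈ Finset.Iio β,
      ((∏ i, (β i).choose (α i) : ℕ) : ℝ) • VPoly.shift (β - α) (canonQ T α v) := by
  rw [← Finset.sum_attach (Finset.Iio β)]
  conv_lhs => rw [canonQ, WellFounded.fix_eq]
  simp only [LinearMap.sub_apply, LinearMap.sum_apply, LinearMap.smul_apply,
    LinearMap.comp_apply, Finsupp.lsingle_apply]
  rfl

theorem canon_sum {n : ℕ} {V : Type*} [AddCommGroup V] [Module ℝ V]
    (Q : (Fin n → ℕ) → (V →ₗ[ℝ] VPoly n V)) (β : Fin n → ℕ) (v : V) :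
    ∑ α ∈ Finset.Iic β,
        ((∏ i, (β i).choose (α i) : ℕ) : ℝ) • VPoly.shift (β - α) (Q α v) =
      Q β v + ∑ α ∈ Finset.Iio β,
        ((∏ i, (β i).choose (α i) : ℕ) : ℝ) • VPoly.shift (β - α) (Q α v) := by
  classical
  have h : Finset.Iic β = insert β (Finset.Iio β) := by
    ext a
    simp [le_iff_eq_or_lt]
  rw [h, Finset.sum_insert (by simp)]
  congr 1
  simp only [VPoly.shift, tsub_self, add_zero, Nat.choose_self, Finset.prod_const_one,
    Nat.cast_one, one_smul]
  exact Finsupp.mapDomain_id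

/-- **Canonical representation of linear operators on `V ⊗ ℝ[x₁,…,xₙ]`.**
For every ℝ-linear operator `T` on `V ⊗ ℝ[x₁,…,xₙ]` there exist unique ℝ-linear maps
`Q_α : V → V ⊗ ℝ[x₁,…,xₙ]` (α ∈ ℕ₀ⁿ) such that
`T(v ⊗ x^β) = Σ_{α ⪯ β} binom(β,α) · Q_α(v) · x^{β−α}` for all `β` and `v`;
equivalently `T = Σ_α (1/α!) · Q_α × ∂^α`. -/
theorem canonical_representation_existsUnique
    (n : ℕ) (V : Type*) [AddCommGroup V] [Module ℝ V]
    (T : VPoly n V →ₗ[ℝ] VPoly n V) :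
    ∃! Q : (Fin n → ℕ) → (V →ₗ[ℝ] VPoly n V),
      ∀ (β : Fin n → ℕ) (v : V),
        T (Finsupp.single β v) =
          ∑ α ∈ Finset.Iic β,
            ((∏ i, (β i).choose (α i) : ℕ) : ℝ) • VPoly.shift (β - α) (Q α v) := by
  refine ⟨canonQ T, fun β v => ?_, fun Q hQ => ?_⟩
  · rw [canon_sum, canonQ_apply]
    abel
  · funext β
    induction β using (wellFounded_lt (α := Fin n → ℕ)).induction with
    | _ β ih =>
      ext1 v
      rw [canonQ_apply, hQ β v, canon_sum, eq_sub_iff_add_eq]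
      congr 1
      refine Finset.sum_congr rfl fun α hα => ?_
      rw [ih α (Finset.mem_Iio.1 hα)]
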